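/- (Criterion for asymmetric testing against the complement.) Let H_0 ⊆ E be measurable and let H_1 = E ∖ H_0, where E is the set of stationary ergodic process distributions over a finite alphabet A. Then there exists an asymmetrically consistent test for H_0 against H_1 if and only if the set H_1 has probability 0 with respect to the ergodic decomposition of every ρ in the closure of H_0, that is, W_ρ(H_1) = 0 for every ρ ∈ cl(H_0). -/

import Mathlib

open MeasureTheory Filter Topology

namespace Paper

variable {A : Type*} [Fintype A] [MeasurableSpace A]

/-- The left shift on one-sided infinite sequences. -/
def shift (x : ℕ → A) : ℕ → A := fun n => x (n + 1)

/-- A process distribution is stationary if it is invariant under the left shift. -/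
def Stationary (ρ : Measure (ℕ → A)) : Prop := Measure.map shift ρ = ρ

/-- The cylinder set of sequences starting with the word `B ∈ A^k`. -/
def wordCyl {k : ℕ} (B : Fin k → A) : Set (ℕ → A) := {x | ∀ i : Fin k, x i = B i}

open Classical in
/-- Empirical frequency `ν(X_{1..n}, B)` of the word `B ∈ A^k` in the first `n` symbols
of `x` (0 when `n < k`). -/
noncomputable def freqWord {k : ℕ} (B : Fin k → A) (n : ℕ) (x : ℕ → A) : ℝ :=
  if k ≤ n then
    (∑ i ∈ Finset.range (n - k + 1), if (∀ j : Fin k, x (i + j) = B j) then (1 : ℝ) else 0) /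
      ((n : ℝ) - k + 1)
  else 0

/-- Ergodicity: the empirical frequency of every finite word converges a.s. to a constant. -/
def ErgodicProc (ρ : Measure (ℕ → A)) : Prop :=
  ∀ (k : ℕ) (B : Fin k → A),
    ∃ c : ℝ, ∀ᵐ x ∂ρ, Tendsto (fun n => freqWord B n x) atTop (𝓝 c)

/-- A stationary ergodic process distribution. -/
def StatErg (ρ : Measure (ℕ → A)) : Prop :=
  IsProbabilityMeasure ρ ∧ Stationary ρ ∧ ErgodicProc ρ

/-- The set `E` of stationary ergodic process distributions over the alphabet `A`. -/
def ergSet (A : Type*) [Fintype A] [MeasurableSpace A] : Set (Measure (ℕ → A)) :=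
  {ρ | StatErg ρ}

/-- Weights `w_k = 1/(k(k+1))` (indexing from 0: `w_k = 1/((k+1)(k+2))`). -/
noncomputable def wt (k : ℕ) : ℝ := 1 / ((k + 1) * (k + 2))

/-- The distributional distance `d(ρ₁,ρ₂) = Σ_k w_k Σ_{B ∈ A^k} |ρ₁(B) − ρ₂(B)|`. -/
noncomputable def dd (ρ₁ ρ₂ : Measure (ℕ → A)) : ℝ :=
  ∑' k : ℕ, wt k * ∑ B : Fin (k + 1) → A,
    |(ρ₁ (wordCyl B)).toReal - (ρ₂ (wordCyl B)).toReal|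

/-- The empirical distributional distance `d̂(X_{1..n}, ρ)`. -/
noncomputable def hatd (n : ℕ) (x : ℕ → A) (ρ : Measure (ℕ → A)) : ℝ :=
  ∑' k : ℕ, wt k * ∑ B : Fin (k + 1) → A,
    |freqWord B n x - (ρ (wordCyl B)).toReal|

/-- The empirical distributional distance from a sample to a hypothesis (set of
process distributions): `d̂(X_{1..n}, H) = inf_{ρ ∈ H} d̂(X_{1..n}, ρ)`. -/
noncomputable def hatdSet (n : ℕ) (x : ℕ → A) (H : Set (Measure (ℕ → A))) : ℝ :=
  ⨅ ρ : H, hatd n x (ρ : Measure (ℕ → A))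

/-- Closure of a set of (stationary) process distributions in the topology of the
distributional distance, taken within the space `S` of stationary process distributions. -/
def closureD (H : Set (Measure (ℕ → A))) : Set (Measure (ℕ → A)) :=
  {ρ | IsProbabilityMeasure ρ ∧ Stationary ρ ∧ ∀ ε : ℝ, 0 < ε → ∃ μ ∈ H, dd ρ μ < ε}

/-- `W` is the ergodic decomposition of the stationary process distribution `ρ`:
a Borel probability measure on the space of process distributions concentrated on the
stationary ergodic ones, with `ρ(s) = ∫ μ(s) dW(μ)` for every measurable `s`. -/
def IsErgodicDecomp (ρ : Measure (ℕ → A)) (W : Measure (Measure (ℕ → A))) : Prop :=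
  IsProbabilityMeasure W ∧ W (ergSet A) = 1 ∧
    ∀ s : Set (ℕ → A), MeasurableSet s → ρ s = ∫⁻ μ, μ s ∂W

/-- A test depends, at sample size `n`, only on the first `n` symbols. -/
def FinHorizon (φ : ℕ → (ℕ → A) → Bool) : Prop :=
  ∀ n x y, (∀ i < n, x i = y i) → φ n x = φ n y

/-- Uniform consistency of a test (`false` = accept `H₀`, `true` = accept `H₁`):
for every `α > 0`, for all large enough sample sizes, both probabilities of error are
less than `α`. -/
def UnifConsistent (φ : ℕ → (ℕ → A) → Bool) (H₀ H₁ : Set (Measure (ℕ → A))) : Prop :=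
  ∀ α : ℝ, 0 < α → ∃ N : ℕ, ∀ n ≥ N,
    (∀ ρ ∈ H₀, ρ {x | φ n x = true} < ENNReal.ofReal α) ∧
    (∀ ρ ∈ H₁, ρ {x | φ n x = false} < ENNReal.ofReal α)

/-- Asymmetric (`α`-level) consistency of a family of tests `ψ α`: Type I error is always
at most `α`, and under every distribution in `H₁`, a.s. the test outputs `1` from some
sample size on. -/
def AsymConsistent (ψ : ℝ → ℕ → (ℕ → A) → Bool) (H₀ H₁ : Set (Measure (ℕ → A))) : Prop :=
  (∀ α : ℝ, α ∈ Set.Ioo (0 : ℝ) 1 → ∀ n : ℕ, ∀ ρ ∈ H₀,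
    ρ {x | ψ α n x = true} ≤ ENNReal.ofReal α) ∧
  (∀ α : ℝ, α ∈ Set.Ioo (0 : ℝ) 1 → ∀ ρ ∈ H₁,
    ∀ᵐ x ∂ρ, ∀ᶠ n in atTop, ψ α n x = true)

section PointwiseErgodic

variable {Ω : Type*} {T : Ω → Ω}

/-- The running maximum of the Birkhoff sums of `g`, the empty sum included, defined through the
recursion `max (0, g + M_n ∘ T)`. -/
noncomputable def maxBirkhoff (T : Ω → Ω) (g : Ω → ℝ) : ℕ → Ω → ℝ
  | 0, _ => 0
  | n + 1, x => max 0 (g x + maxBirkhoff T g n (T x))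

lemma maxBirkhoff_nonneg (g : Ω → ℝ) (n : ℕ) (x : Ω) : 0 ≤ maxBirkhoff T g n x := by
  cases n <;> simp [maxBirkhoff]

lemma maxBirkhoff_le_succ (g : Ω → ℝ) (n : ℕ) (x : Ω) :
    maxBirkhoff T g n x ≤ maxBirkhoff T g (n + 1) x := by
  induction n generalizing x with
  | zero => simp [maxBirkhoff]
  | succ n ih => exact max_le_max le_rfl (by linarith [ih (T x)])

lemma birkhoffSum_le_maxBirkhoff (g : Ω → ℝ) (n : ℕ) (x : Ω) :
    birkhoffSum T g n x ≤ maxBirkhoff T g n x := by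
  induction n generalizing x with
  | zero => simp [maxBirkhoff]
  | succ n ih =>
    rw [birkhoffSum_succ']
    exact le_trans (by linarith [ih (T x)]) (le_max_right _ _)

variable [MeasurableSpace Ω] {μ : Measure Ω}

lemma measurable_maxBirkhoff (hT : Measurable T) {g : Ω → ℝ} (hg : Measurable g) (n : ℕ) :
    Measurable (maxBirkhoff T g n) := by
  induction n with
  | zero => exact measurable_const
  | succ n ih => exact measurable_const.max (hg.add (ih.comp hT))

lemma integrable_maxBirkhoff (hT : MeasurePreserving T μ μ) {g : Ω → ℝ} (hg : Integrable g μ)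
    (n : ℕ) : Integrable (maxBirkhoff T g n) μ := by
  induction n with
  | zero => exact integrable_zero _ _ _
  | succ n ih => exact (integrable_zero _ _ _).sup (hg.add (hT.integrable_comp_of_integrable ih))

/-- If `g` has negative integral over every non-null invariant set, then its Birkhoff sums are
almost everywhere bounded above. -/
lemma ae_bddAbove_birkhoffSum (hT : MeasurePreserving T μ μ) {g : Ω → ℝ} (hg : Measurable g)
    (hgi : Integrable g μ)
    (hneg : ∀ G, MeasurableSet[MeasurableSpace.invariants T] G → μ G ≠ 0 → ∫ x in G, g x ∂μ < 0) :
    ∀ᵐ x ∂μ, BddAbove (Set.range fun n => birkhoffSum T g n x) := by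
  set M := maxBirkhoff T g with hM
  have hMm := measurable_maxBirkhoff hT.measurable hg
  have hMi := integrable_maxBirkhoff hT hgi
  have hmono : ∀ x, Monotone fun n => M n x := fun x =>
    monotone_nat_of_le_succ fun n => maxBirkhoff_le_succ g n x
  set G : Set Ω := {x | BddAbove (Set.range fun n => M n x)}ᶜ with hG
  have hGm : MeasurableSet G := (measurableSet_bddAbove_range hMm).compl
  have hGinv : T ⁻¹' G = G := by
    rw [hG, Set.preimage_compl]
    congr 1
    ext x
    simp only [Set.mem_preimage, Set.mem_ofPred_eq]
    constructor
    · rintro ⟨c, hc⟩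
      refine ⟨max 0 (g x + c), ?_⟩
      rintro _ ⟨n, rfl⟩
      refine (hmono x n.le_succ).trans ?_
      exact max_le_max le_rfl (by linarith [hc ⟨n, rfl⟩])
    · rintro ⟨c, hc⟩
      refine ⟨c - g x, ?_⟩
      rintro _ ⟨n, rfl⟩
      have h1 : M (n + 1) x ≤ c := hc ⟨n + 1, rfl⟩
      have h2 : g x + M n (T x) ≤ M (n + 1) x := le_max_right _ _
      change M n (T x) ≤ _
      linarith
  have hint : ∀ n, ∫ x in G, M n (T x) ∂μ = ∫ x in G, M n x ∂μ := fun n => by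
    have h := setIntegral_map (μ := μ) (g := T) (f := M n) hGm
      (hMm n).aestronglyMeasurable hT.aemeasurable
    rw [hT.map_eq, hGinv] at h
    exact h.symm
  have hnonneg : 0 ≤ ∫ x in G, g x ∂μ := by
    refine ge_of_tendsto' (tendsto_integral_of_dominated_convergence
      (F := fun n x => M (n + 1) x - M n (T x)) (fun x => |g x|)
      (fun n => ((hMm _).sub ((hMm n).comp hT.measurable)).aestronglyMeasurable)
      hgi.abs.integrableOn (fun n => ae_of_all _ fun x => ?_)
      ((ae_restrict_iff' hGm).2 <| ae_of_all _ fun x hx => ?_)) fun n => ?_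
    · have h0 : 0 ≤ M n (T x) := maxBirkhoff_nonneg g n (T x)
      have h1 : M (n + 1) x = max 0 (g x + M n (T x)) := rfl
      rw [h1, Real.norm_eq_abs, abs_le]
      constructor
      · have := le_max_right 0 (g x + M n (T x))
        linarith [neg_abs_le (g x)]
      · have : max 0 (g x + M n (T x)) ≤ |g x| + M n (T x) :=
          max_le (by positivity) (by linarith [le_abs_self (g x)])
        linarith
    · have hTx : T x ∈ G := by rw [← hGinv] at hx; exact hx
      refine tendsto_const_nhds.congr' ?_
      have hub : ∃ n, -g x < M n (T x) := by
        by_contra! h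
        exact hTx ⟨-g x, by rintro _ ⟨n, rfl⟩; exact h n⟩
      obtain ⟨n₀, hn₀⟩ := hub
      filter_upwards [eventually_ge_atTop n₀] with n hn
      have h1 : M (n + 1) x = max 0 (g x + M n (T x)) := rfl
      have h2 : M n₀ (T x) ≤ M n (T x) := hmono (T x) hn
      rw [h1, max_eq_right (by linarith)]
      ring
    · have hi : Integrable (fun x => M n (T x)) μ := hT.integrable_comp_of_integrable (hMi n)
      have hi' : Integrable (M (n + 1)) μ := hMi _
      rw [integral_sub hi'.integrableOn hi.integrableOn, hint, sub_nonneg]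
      exact setIntegral_mono (hMi _).integrableOn (hMi _).integrableOn fun x => hmono x n.le_succ
  have hnull : μ G = 0 := by
    by_contra h
    exact absurd (hneg G ⟨hGm, hGinv⟩ h) (not_lt.2 hnonneg)
  have hae : ∀ᵐ x ∂μ, x ∉ G := measure_eq_zero_iff_ae_notMem.1 hnull
  filter_upwards [hae] with x hx
  obtain ⟨c, hc⟩ := not_not.1 hx
  refine ⟨c, ?_⟩
  rintro _ ⟨n, rfl⟩
  exact (birkhoffSum_le_maxBirkhoff g n x).trans (hc ⟨n, rfl⟩)

/-- The upper half of the pointwise ergodic theorem. -/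
lemma ae_eventually_birkhoffAverage_le [IsProbabilityMeasure μ] (hT : MeasurePreserving T μ μ)
    {f : Ω → ℝ} (hf : Measurable f) (hfi : Integrable f μ) :
    ∀ᵐ x ∂μ, ∀ ε > 0, ∀ᶠ n in atTop,
      birkhoffAverage ℝ T f n x ≤ (μ[f | MeasurableSpace.invariants T]) x + ε := by
  have hle := MeasurableSpace.invariants_le T
  set E := μ[f | MeasurableSpace.invariants T] with hE
  have hEm : Measurable[MeasurableSpace.invariants T] E := stronglyMeasurable_condExp.measurable
  have hEm' : Measurable E := hEm.mono hle le_rfl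
  have hEinv : E ∘ T = E := MeasurableSpace.comp_eq_of_measurable_invariants hEm
  have hEi : Integrable E μ := integrable_condExp
  have key : ∀ k : ℕ, ∀ᵐ x ∂μ, BddAbove (Set.range fun n =>
      birkhoffSum T (fun y => f y - E y - 1 / ((k : ℝ) + 1)) n x) := fun k => by
    refine ae_bddAbove_birkhoffSum hT ((hf.sub hEm').sub measurable_const)
      ((hfi.sub hEi).sub (integrable_const _)) fun G hG hpos => ?_
    have hi : Integrable (fun y => f y - E y) μ := hfi.sub hEi
    rw [integral_sub hi.integrableOn (integrable_const _),
      integral_sub hfi.integrableOn hEi.integrableOn, setIntegral_condExp hle hfi hG]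
    have hr : 0 < μ.real G := ENNReal.toReal_pos hpos (measure_ne_top μ G)
    simp only [sub_self, setIntegral_const, smul_eq_mul, zero_sub, Left.neg_neg_iff]
    positivity
  filter_upwards [ae_all_iff.2 key] with x hx ε hε
  obtain ⟨k, hk⟩ := exists_nat_one_div_lt (half_pos hε)
  obtain ⟨c, hc⟩ := hx k
  have hEit : ∀ i, E (T^[i] x) = E x := fun i => by
    induction i with
    | zero => rfl
    | succ i ih => rw [Function.iterate_succ_apply', ← ih]; exact congrFun hEinv _
  have hsum : ∀ n, birkhoffSum T (fun y => f y - E y - 1 / ((k : ℝ) + 1)) n x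
      = birkhoffSum T f n x - n * (E x + 1 / ((k : ℝ) + 1)) := fun n => by
    simp only [birkhoffSum, hEit, Finset.sum_sub_distrib, Finset.sum_const, Finset.card_range,
      nsmul_eq_mul]
    ring
  filter_upwards [eventually_gt_atTop 0, eventually_ge_atTop ⌈c / (ε / 2)⌉₊] with n hn hnc
  have hn' : (0 : ℝ) < n := Nat.cast_pos.2 hn
  have h1 : birkhoffSum T f n x ≤ c + n * (E x + 1 / ((k : ℝ) + 1)) := by
    have := hc ⟨n, rfl⟩
    simp only [hsum] at this
    linarith
  have h2 : c ≤ n * (ε / 2) := by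
    have := Nat.ceil_le.1 hnc
    rwa [div_le_iff₀ (half_pos hε)] at this
  rw [birkhoffAverage, smul_eq_mul, inv_mul_le_iff₀ hn']
  nlinarith

/-- The pointwise ergodic theorem. -/
theorem ae_tendsto_birkhoffAverage [IsProbabilityMeasure μ] (hT : MeasurePreserving T μ μ)
    {f : Ω → ℝ} (hf : Measurable f) (hfi : Integrable f μ) :
    ∀ᵐ x ∂μ, Tendsto (fun n => birkhoffAverage ℝ T f n x) atTop
      (𝓝 ((μ[f | MeasurableSpace.invariants T]) x)) := by
  filter_upwards [ae_eventually_birkhoffAverage_le hT hf hfi,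
    ae_eventually_birkhoffAverage_le hT hf.neg hfi.neg,
    condExp_neg f (MeasurableSpace.invariants T) (μ := μ)] with x h1 h2 h3
  rw [Metric.tendsto_nhds]
  intro ε hε
  filter_upwards [h1 (ε / 2) (half_pos hε), h2 (ε / 2) (half_pos hε)] with n hn1 hn2
  rw [h3, birkhoffAverage_neg] at hn2
  simp only [Pi.neg_apply] at hn2
  rw [Real.dist_eq, abs_lt]
  constructor <;> linarith

lemma integral_birkhoffAverage [IsFiniteMeasure μ] (hT : MeasurePreserving T μ μ) {f : Ω → ℝ}
    (hf : Measurable f) (hfi : Integrable f μ) {n : ℕ} (hn : n ≠ 0) :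
    ∫ x, birkhoffAverage ℝ T f n x ∂μ = ∫ x, f x ∂μ := by
  have h : ∀ i, ∫ x, f (T^[i] x) ∂μ = ∫ x, f x ∂μ := fun i => by
    have hTi := hT.iterate i
    conv_rhs => rw [← hTi.map_eq]
    exact (integral_map hTi.aemeasurable hf.aestronglyMeasurable).symm
  simp only [birkhoffAverage, birkhoffSum, smul_eq_mul]
  have hi : ∀ i ∈ Finset.range n, Integrable (fun x => f (T^[i] x)) μ := fun i _ =>
    (hT.iterate i).integrable_comp_of_integrable hfi
  rw [integral_const_mul, integral_finsetSum _ hi]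
  simp only [h, Finset.sum_const, Finset.card_range, nsmul_eq_mul]
  field_simp

end PointwiseErgodic

section Words

omit [Fintype A] [MeasurableSpace A]

lemma iterate_shift_apply (i j : ℕ) (x : ℕ → A) : shift^[i] x j = x (i + j) := by
  induction i generalizing x with
  | zero => simp
  | succ i ih =>
    rw [Function.iterate_succ_apply, ih]
    simp only [shift]
    congr 1
    ring

/-- A set of sequences that is determined by the first `n` symbols. -/
def FinDep (n : ℕ) (S : Set (ℕ → A)) : Prop :=
  ∀ x y, (∀ i < n, x i = y i) → x ∈ S → y ∈ S

lemma finDep_wordCyl {k : ℕ} (B : Fin k → A) : FinDep k (wordCyl B) :=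
  fun _ _ h hx i => (h i i.2).symm.trans (hx i)

lemma mem_wordCyl_self (k : ℕ) (x : ℕ → A) : x ∈ wordCyl (fun i : Fin k => x i) := fun _ => rfl

lemma eq_of_mem_wordCyl {k : ℕ} {B C : Fin k → A} {x : ℕ → A} (hB : x ∈ wordCyl B)
    (hC : x ∈ wordCyl C) : B = C :=
  funext fun i => (hB i).symm.trans (hC i)

lemma freqWord_eq_birkhoffAverage {k n : ℕ} (hkn : k ≤ n) (B : Fin k → A) (x : ℕ → A) :
    freqWord B n x = birkhoffAverage ℝ shift ((wordCyl B).indicator 1) (n - k + 1) x := by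
  classical
  rw [freqWord, if_pos hkn, birkhoffAverage, birkhoffSum, smul_eq_mul, div_eq_inv_mul]
  congr 1
  · push_cast [Nat.cast_sub hkn]
    ring
  · refine Finset.sum_congr rfl fun i _ => ?_
    simp [Set.indicator_apply, wordCyl, iterate_shift_apply]

lemma freqWord_eq_of_eqOn {k n : ℕ} (B : Fin k → A) {x y : ℕ → A} (h : ∀ i < n, x i = y i) :
    freqWord B n x = freqWord B n y := by
  classical
  unfold freqWord
  split_ifs with hkn
  · congr 1
    refine Finset.sum_congr rfl fun i hi => ?_
    have : ∀ j : Fin k, x (i + j) = y (i + j) := fun j =>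
      h _ (by have := Finset.mem_range.1 hi; have := j.2; omega)
    exact if_congr (forall_congr' fun j => by rw [this j]) rfl rfl
  · rfl

lemma freqWord_nonneg {k : ℕ} (B : Fin k → A) (n : ℕ) (x : ℕ → A) : 0 ≤ freqWord B n x := by
  unfold freqWord
  split_ifs with hkn
  · have : (k : ℝ) ≤ n := Nat.cast_le.2 hkn
    refine div_nonneg (Finset.sum_nonneg fun i _ => ?_) (by linarith)
    split_ifs <;> norm_num
  · exact le_rfl

lemma freqWord_le_one {k : ℕ} (B : Fin k → A) (n : ℕ) (x : ℕ → A) : freqWord B n x ≤ 1 := by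
  unfold freqWord
  split_ifs with hkn
  · have : (k : ℝ) ≤ n := Nat.cast_le.2 hkn
    refine div_le_one_of_le₀ ((Finset.sum_le_card_nsmul _ _ 1 fun i _ => ?_).trans ?_)
      (by linarith)
    · split_ifs <;> norm_num
    · simp [Nat.cast_sub hkn]
  · exact zero_le_one

end Words

section Measures

/-- Almost every sequence uses only letters whose singletons are measurable. -/
def GoodLetters (μ : Measure (ℕ → A)) : Prop :=
  ∀ᵐ x ∂μ, ∀ i, MeasurableSet ({x i} : Set A)

omit [Fintype A] in
lemma measurable_shift : Measurable (shift : (ℕ → A) → ℕ → A) :=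
  measurable_pi_lambda _ fun _ => measurable_pi_apply _

omit [Fintype A] in
lemma Stationary.measurePreserving {μ : Measure (ℕ → A)} (h : Stationary μ) :
    MeasurePreserving shift μ μ := ⟨measurable_shift, h⟩

omit [Fintype A] in
lemma measurableSet_wordCyl_of_letters {k : ℕ} {B : Fin k → A}
    (h : ∀ i, MeasurableSet ({B i} : Set A)) : MeasurableSet (wordCyl B) := by
  have : wordCyl B = ⋂ i : Fin k, (fun x : ℕ → A => x i) ⁻¹' {B i} := by
    ext x; simp [wordCyl]
  rw [this]
  exact MeasurableSet.iInter fun i => measurable_pi_apply _ (h i)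

omit [Fintype A] in
lemma GoodLetters.measure_wordCyl_eq_zero {μ : Measure (ℕ → A)} (hμ : GoodLetters μ) {k : ℕ}
    {B : Fin k → A} (h : ¬ ∀ i, MeasurableSet ({B i} : Set A)) : μ (wordCyl B) = 0 := by
  push Not at h
  obtain ⟨i, hi⟩ := h
  rw [measure_eq_zero_iff_ae_notMem]
  filter_upwards [hμ] with x hx hxB
  exact hi (hxB i ▸ hx i)

omit [Fintype A] in
lemma GoodLetters.nullMeasurableSet_wordCyl {μ : Measure (ℕ → A)} (hμ : GoodLetters μ) {k : ℕ}
    (B : Fin k → A) : NullMeasurableSet (wordCyl B) μ := by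
  by_cases h : ∀ i, MeasurableSet ({B i} : Set A)
  · exact (measurableSet_wordCyl_of_letters h).nullMeasurableSet
  · exact NullMeasurableSet.of_null (hμ.measure_wordCyl_eq_zero h)

open Classical in
/-- The words of length `n` that can be extended to a sequence in `S`. -/
noncomputable def wordsOf (n : ℕ) (S : Set (ℕ → A)) : Finset (Fin n → A) :=
  Finset.univ.filter fun B => ∃ x ∈ S, x ∈ wordCyl B

omit [MeasurableSpace A] in
lemma FinDep.biUnion_wordsOf {n : ℕ} {S : Set (ℕ → A)} (hS : FinDep n S) :
    ⋃ B ∈ wordsOf n S, wordCyl B = S := by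
  ext x
  simp only [wordsOf, Set.mem_iUnion, Finset.mem_filter, Finset.mem_univ, true_and, exists_prop]
  constructor
  · rintro ⟨B, ⟨y, hyS, hyB⟩, hxB⟩
    exact hS y x (fun i hi => (hyB ⟨i, hi⟩).trans (hxB ⟨i, hi⟩).symm) hyS
  · exact fun hx => ⟨_, ⟨x, hx, mem_wordCyl_self n x⟩, mem_wordCyl_self n x⟩

lemma GoodLetters.real_eq_sum {μ : Measure (ℕ → A)} [IsFiniteMeasure μ] (hμ : GoodLetters μ)
    {n : ℕ} {S : Set (ℕ → A)} (hS : FinDep n S) :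
    μ.real S = ∑ B ∈ wordsOf n S, μ.real (wordCyl B) := by
  conv_lhs => rw [← hS.biUnion_wordsOf]
  refine measureReal_biUnion_finset₀ (fun B _ C _ hBC => ?_)
    fun B _ => hμ.nullMeasurableSet_wordCyl B
  refine Disjoint.aedisjoint (Set.disjoint_left.2 fun x hB hC => hBC (eq_of_mem_wordCyl hB hC))

lemma GoodLetters.sum_wordCyl {μ : Measure (ℕ → A)} [IsProbabilityMeasure μ]
    (hμ : GoodLetters μ) (n : ℕ) : ∑ B : Fin n → A, μ.real (wordCyl B) ≤ 1 := by
  have hdisj : Set.Pairwise (↑(Finset.univ : Finset (Fin n → A)))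
      (Function.onFun (AEDisjoint μ) fun B : Fin n → A => wordCyl B) := fun B _ C _ hBC =>
    Disjoint.aedisjoint (Set.disjoint_left.2 fun x hB hC => hBC (eq_of_mem_wordCyl hB hC))
  rw [← measureReal_biUnion_finset₀ hdisj fun B _ => hμ.nullMeasurableSet_wordCyl B]
  exact measureReal_le_one

end Measures

section Discrete

variable [MeasurableSingletonClass A]

omit [Fintype A] in
lemma measurableSet_wordCyl {k : ℕ} (B : Fin k → A) : MeasurableSet (wordCyl B) :=
  measurableSet_wordCyl_of_letters fun _ => measurableSet_singleton _

omit [Fintype A] in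
lemma goodLetters (μ : Measure (ℕ → A)) : GoodLetters μ :=
  ae_of_all _ fun _ _ => measurableSet_singleton _

lemma FinDep.measurableSet {n : ℕ} {S : Set (ℕ → A)} (hS : FinDep n S) : MeasurableSet S := by
  rw [← hS.biUnion_wordsOf]
  exact Finset.measurableSet_biUnion _ fun B _ => measurableSet_wordCyl B

lemma measurable_of_finHorizon {φ : ℕ → (ℕ → A) → Bool} (hφ : FinHorizon φ) (n : ℕ) :
    Measurable (φ n) := by
  refine measurable_to_bool (FinDep.measurableSet (n := n) fun x y h hx => ?_)
  simpa [← hφ n x y h] using hx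

omit [Fintype A] in
lemma measurable_wordCyl_indicator {k : ℕ} (B : Fin k → A) :
    Measurable ((wordCyl B).indicator (1 : (ℕ → A) → ℝ)) :=
  measurable_one.indicator (measurableSet_wordCyl B)

omit [Fintype A] in
lemma measurable_freqWord {k : ℕ} (B : Fin k → A) (n : ℕ) : Measurable (freqWord B n) := by
  by_cases hkn : k ≤ n
  · have h : Measurable fun x : ℕ → A => ∑ i ∈ Finset.range (n - k + 1),
        (wordCyl B).indicator (1 : (ℕ → A) → ℝ) (shift^[i] x) :=
      Finset.measurable_sum _ fun i _ =>
        (measurable_wordCyl_indicator B).comp (measurable_shift.iterate i)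
    have h' : freqWord B n = fun x => ((n - k + 1 : ℕ) : ℝ)⁻¹ * ∑ i ∈ Finset.range (n - k + 1),
        (wordCyl B).indicator (1 : (ℕ → A) → ℝ) (shift^[i] x) :=
      funext fun x => freqWord_eq_birkhoffAverage hkn B x
    rw [h']
    exact h.const_mul _
  · have : freqWord B n = fun _ => 0 := by ext x; simp [freqWord, hkn]
    rw [this]
    exact measurable_const

omit [Fintype A] in
lemma integrable_freqWord {k : ℕ} (B : Fin k → A) (n : ℕ) (μ : Measure (ℕ → A))
    [IsFiniteMeasure μ] : Integrable (freqWord B n) μ :=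
  Integrable.of_bound (measurable_freqWord B n).aestronglyMeasurable 1 <| ae_of_all _ fun x => by
    rw [Real.norm_of_nonneg (freqWord_nonneg B n x)]
    exact freqWord_le_one B n x

omit [Fintype A] in
lemma integral_freqWord {μ : Measure (ℕ → A)} [IsFiniteMeasure μ] (hμ : Stationary μ) {k n : ℕ}
    (hkn : k ≤ n) (B : Fin k → A) : ∫ x, freqWord B n x ∂μ = μ.real (wordCyl B) := by
  simp only [freqWord_eq_birkhoffAverage hkn B]
  rw [integral_birkhoffAverage hμ.measurePreserving (measurable_wordCyl_indicator B)
    ((integrable_const 1).indicator (measurableSet_wordCyl B)) (Nat.succ_ne_zero _)]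
  exact integral_indicator_one (measurableSet_wordCyl B)

omit [Fintype A] in
/-- Under a stationary ergodic distribution word frequencies converge to word probabilities. -/
lemma StatErg.ae_tendsto_freqWord {μ : Measure (ℕ → A)} (hμ : StatErg μ) {k : ℕ}
    (B : Fin k → A) :
    ∀ᵐ x ∂μ, Tendsto (fun n => freqWord B n x) atTop (𝓝 (μ.real (wordCyl B))) := by
  have := hμ.1
  obtain ⟨c, hc⟩ := hμ.2.2 k B
  have h1 : Tendsto (fun n => ∫ x, freqWord B n x ∂μ) atTop (𝓝 (∫ _, c ∂μ)) :=
    tendsto_integral_of_dominated_convergence (fun _ => 1)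
      (fun n => (measurable_freqWord B n).aestronglyMeasurable) (integrable_const _)
      (fun n => ae_of_all _ fun x => by
        rw [Real.norm_of_nonneg (freqWord_nonneg B n x)]
        exact freqWord_le_one B n x) hc
  have h2 : Tendsto (fun n => ∫ x, freqWord B n x ∂μ) atTop (𝓝 (μ.real (wordCyl B))) :=
    tendsto_const_nhds.congr' <| by
      filter_upwards [eventually_ge_atTop k] with n hn using (integral_freqWord hμ.2.1 hn B).symm
  have h3 : c = μ.real (wordCyl B) := by
    simpa using tendsto_nhds_unique h1 h2
  rwa [h3] at hc

/-- A finite measure on sequences is determined by the probabilities of words. -/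
lemma measure_ext_of_wordCyl {μ ν : Measure (ℕ → A)} [IsProbabilityMeasure μ]
    [IsProbabilityMeasure ν]
    (h : ∀ (k : ℕ) (B : Fin k → A), μ.real (wordCyl B) = ν.real (wordCyl B)) : μ = ν := by
  refine ext_of_generate_finite (measurableCylinders fun _ : ℕ => A)
    generateFrom_measurableCylinders.symm isPiSystem_measurableCylinders (fun S hS => ?_) (by simp)
  obtain ⟨s, S', -, rfl⟩ := (mem_measurableCylinders _).1 hS
  have hdep : FinDep (s.sup id + 1) (cylinder s S') := fun x y hxy hx => by
    rw [mem_cylinder] at hx ⊢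
    convert hx using 1
    ext i
    exact (hxy i (Nat.lt_succ_of_le (Finset.le_sup (f := id) i.2))).symm
  rw [← measureReal_eq_measureReal_iff, (goodLetters μ).real_eq_sum hdep,
    (goodLetters ν).real_eq_sum hdep]
  exact Finset.sum_congr rfl fun B _ => h _ B

end Discrete

section Compactness

variable [MeasurableSingletonClass A]

/-- Sequential compactness, along an ultrafilter, of the set of stationary distributions. -/
lemma exists_stationary_limit (ρ : ℕ → Measure (ℕ → A))
    (hp : ∀ j, IsProbabilityMeasure (ρ j)) (hs : ∀ j, Stationary (ρ j)) :
    ∃ ρ' : Measure (ℕ → A), IsProbabilityMeasure ρ' ∧ Stationary ρ' ∧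
      ∀ (n : ℕ) (S : Set (ℕ → A)), FinDep n S →
        Tendsto (fun j => (ρ j).real S) (hyperfilter ℕ) (𝓝 (ρ'.real S)) := by
  let _ : TopologicalSpace A := ⊥
  have : DiscreteTopology A := ⟨rfl⟩
  have : BorelSpace A := inferInstance
  let P : ℕ → ProbabilityMeasure (ℕ → A) := fun j => ⟨ρ j, hp j⟩
  obtain ⟨ρ', -, hρ'⟩ := isCompact_univ.ultrafilter_le_nhds ((hyperfilter ℕ).map P) (by simp)
  have hlim : Tendsto P (hyperfilter ℕ) (𝓝 ρ') := hρ'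
  have hconv : ∀ (n : ℕ) (S : Set (ℕ → A)), FinDep n S →
      Tendsto (fun j => (ρ j).real S) (hyperfilter ℕ)
        (𝓝 ((ρ' : Measure (ℕ → A)).real S)) := fun n S hS => by
    have hopen : ∀ S : Set (ℕ → A), FinDep n S → IsOpen S := fun S hS => by
      rw [← hS.biUnion_wordsOf]
      refine isOpen_biUnion fun B _ => ?_
      have : wordCyl B = ⋂ i : Fin n, (fun x : ℕ → A => x i) ⁻¹' {B i} := by
        ext x; simp [wordCyl]
      rw [this]
      exact isOpen_iInter_of_finite fun i => (isOpen_discrete _).preimage (continuous_apply _)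
    have hclopen : IsClopen S :=
      ⟨⟨hopen _ fun x y h hx hy => hx (hS y x (fun i hi => (h i hi).symm) hy)⟩, hopen _ hS⟩
    have h := ProbabilityMeasure.tendsto_measure_of_null_frontier_of_tendsto hlim (E := S)
      (by simp [hclopen.frontier_eq])
    exact (NNReal.tendsto_coe.2 h)
  refine ⟨ρ', inferInstance, ?_, hconv⟩
  have : IsProbabilityMeasure (Measure.map shift (ρ' : Measure (ℕ → A))) :=
    Measure.isProbabilityMeasure_map measurable_shift.aemeasurable
  refine measure_ext_of_wordCyl fun k B => ?_
  have hdep : FinDep (k + 1) (shift ⁻¹' wordCyl B) := fun x y h hx i =>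
    (h (i + 1) (by omega)).symm.trans (hx i)
  rw [map_measureReal_apply measurable_shift (measurableSet_wordCyl B)]
  refine tendsto_nhds_unique (hconv _ _ hdep) ((hconv _ _ (finDep_wordCyl B)).congr fun j => ?_)
  rw [← map_measureReal_apply measurable_shift (measurableSet_wordCyl B), hs j]

/-- The σ-algebra of shift-invariant events. -/
abbrev shiftInvariants (A : Type*) [MeasurableSpace A] : MeasurableSpace (ℕ → A) :=
  MeasurableSpace.invariants shift

/-- Existence of the ergodic decomposition, as a measurable family of stationary ergodic
distributions whose word probabilities are the limiting frequencies of words. -/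
lemma exists_ergodic_decomposition (ρ : Measure (ℕ → A)) [IsProbabilityMeasure ρ]
    (hs : Stationary ρ) :
    ∃ κ : (ℕ → A) → Measure (ℕ → A), Measurable κ ∧ (∀ᵐ x ∂ρ, StatErg (κ x)) ∧
      (∀ s, MeasurableSet s → ρ s = ∫⁻ x, κ x s ∂ρ) ∧
      ∀ᵐ x ∂ρ, ∀ (k : ℕ) (B : Fin k → A),
        Tendsto (fun n => freqWord B n x) atTop (𝓝 ((κ x).real (wordCyl B))) := by
  have hle : shiftInvariants A ≤ MeasurableSpace.pi := MeasurableSpace.invariants_le _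
  set κ := ProbabilityTheory.condExpKernel ρ (shiftInvariants A) with hκ
  have hmp := hs.measurePreserving
  have hκreal : ∀ s, MeasurableSet s → (fun x => (κ x).real s) =ᵐ[ρ]
      ρ[s.indicator fun _ => 1 | shiftInvariants A] := fun s h =>
    ProbabilityTheory.condExpKernel_ae_eq_condExp hle h
  have hint : ∀ s : Set (ℕ → A), MeasurableSet s →
      Integrable (s.indicator fun _ => (1 : ℝ)) ρ := fun s h => (integrable_const _).indicator h
  have hfreq : ∀ᵐ x ∂ρ, ∀ (k : ℕ) (B : Fin k → A),
      Tendsto (fun n => freqWord B n x) atTop (𝓝 ((κ x).real (wordCyl B))) := by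
    refine ae_all_iff.2 fun k => ae_all_iff.2 fun B => ?_
    filter_upwards [ae_tendsto_birkhoffAverage hmp (measurable_wordCyl_indicator B)
      (hint _ (measurableSet_wordCyl B)), hκreal _ (measurableSet_wordCyl B)] with x h1 h2
    rw [h2]
    have h3 : Tendsto (fun n => n - k + 1) atTop atTop :=
      (tendsto_add_atTop_nat 1).comp (tendsto_sub_atTop_nat k)
    refine (h1.comp h3).congr' ?_
    filter_upwards [eventually_ge_atTop k] with n hn
    exact (freqWord_eq_birkhoffAverage hn B x).symm
  have hmeas : Measurable[shiftInvariants A] κ := ProbabilityTheory.Kernel.measurable κ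
  refine ⟨κ, hmeas.mono hle le_rfl, ?_, fun s h => ?_, hfreq⟩
  · have hprob : ∀ x, IsProbabilityMeasure (κ x) := fun x => inferInstance
    have hstat : ∀ᵐ x ∂ρ, Stationary (κ x) := by
      have h : ∀ᵐ x ∂ρ, ∀ (k : ℕ) (B : Fin k → A),
          (κ x).real (shift ⁻¹' wordCyl B) = (κ x).real (wordCyl B) := by
        refine ae_all_iff.2 fun k => ae_all_iff.2 fun B => ?_
        have hB := measurableSet_wordCyl B
        have hB' := measurable_shift hB
        refine (hκreal _ hB').trans (EventuallyEq.trans ?_ (hκreal _ hB).symm)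
        refine (ae_eq_condExp_of_forall_setIntegral_eq hle (hint _ hB)
          (fun s _ _ => integrable_condExp.integrableOn) (fun G hG _ => ?_)
          stronglyMeasurable_condExp.aestronglyMeasurable)
        rw [setIntegral_condExp hle (hint _ hB') hG]
        have h := setIntegral_map (μ := ρ) (g := shift)
          (f := (wordCyl B).indicator fun _ => (1 : ℝ)) hG.1
          ((measurable_wordCyl_indicator B).aestronglyMeasurable) hmp.aemeasurable
        rw [hmp.map_eq, hG.2] at h
        exact h.symm
      filter_upwards [h] with x hx
      have : IsProbabilityMeasure (Measure.map shift (κ x)) :=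
        Measure.isProbabilityMeasure_map measurable_shift.aemeasurable
      refine measure_ext_of_wordCyl fun k B => ?_
      rw [map_measureReal_apply measurable_shift (measurableSet_wordCyl B)]
      exact hx k B
    have herg : ∀ᵐ x ∂ρ, ∀ (k : ℕ) (B : Fin k → A), ∀ᵐ y ∂κ x,
        Tendsto (fun n => freqWord B n y) atTop (𝓝 ((κ x).real (wordCyl B))) := by
      refine ae_all_iff.2 fun k => ae_all_iff.2 fun B => ae_of_ae_trim hle ?_
      refine Measure.ae_ae_of_ae_compProd (κ := κ) (p := fun z =>
        Tendsto (fun n => freqWord B n z.2) atTop (𝓝 ((κ z.1).real (wordCyl B)))) ?_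
      rw [ProbabilityTheory.compProd_trim_condExpKernel hle]
      have hk : Measurable[(shiftInvariants A).prod MeasurableSpace.pi] fun z : (ℕ → A) × (ℕ → A) =>
          (κ z.1).real (wordCyl B) := by
        have h : Measurable[shiftInvariants A] fun x => (κ x).real (wordCyl B) :=
          ((Measure.measurable_coe (measurableSet_wordCyl B)).comp hmeas).ennreal_toReal
        exact h.comp measurable_fst
      have hset : MeasurableSet[(shiftInvariants A).prod MeasurableSpace.pi]
          {z : (ℕ → A) × (ℕ → A) |
            Tendsto (fun n => freqWord B n z.2) atTop (𝓝 ((κ z.1).real (wordCyl B)))} :=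
        @measurableSet_tendsto_fun ℕ ℝ ((ℕ → A) × (ℕ → A))
          ((shiftInvariants A).prod MeasurableSpace.pi) _ _ _ _ _ _ _ _ _
          (fun n => (measurable_freqWord B n).comp
            (@measurable_snd _ _ (shiftInvariants A) MeasurableSpace.pi)) _ hk
      have hdiag : @Measurable _ _ MeasurableSpace.pi
          ((shiftInvariants A).prod MeasurableSpace.pi) (Function.diag : (ℕ → A) → _) :=
        @Measurable.prodMk _ MeasurableSpace.pi _ _ (shiftInvariants A) MeasurableSpace.pi _ _
          (measurable_id'' hle) measurable_id
      refine (@ae_map_iff _ _ _ ((shiftInvariants A).prod MeasurableSpace.pi) _ _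
        (@Measurable.aemeasurable _ _ _ ((shiftInvariants A).prod MeasurableSpace.pi) _ _ hdiag)
        _ hset).2 ?_
      filter_upwards [hfreq] with x hx using hx k B
    filter_upwards [hstat, herg] with x h1 h2
    exact ⟨hprob x, h1, fun k B => ⟨_, h2 k B⟩⟩
  · have hm : Measurable[shiftInvariants A] (fun x => κ x s) :=
      (Measure.measurable_coe h).comp hmeas
    rw [← lintegral_trim hle hm]
    conv_lhs => rw [← ProbabilityTheory.condExpKernel_comp_trim (μ := ρ) hle]
    rw [Measure.bind_apply h κ.aemeasurable]

end Compactness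

section LevelTest

/-- Finite words over the alphabet `A`. -/
abbrev Word (A : Type*) := Σ k : ℕ, Fin k → A

/-- The probabilities of all finite words. -/
noncomputable def wordVec (μ : Measure (ℕ → A)) (w : Word A) : ℝ := μ.real (wordCyl w.2)

/-- The sequences whose word frequencies at time `m` are `ε`-close to prescribed values. -/
def freqBox (C : Finset (Word A × ℚ)) (ε : ℝ) (m : ℕ) : Set (ℕ → A) :=
  {x | ∀ p ∈ C, |freqWord p.1.2 m x - p.2| ≤ ε}

omit [Fintype A] [MeasurableSpace A] in
lemma finDep_freqBox (C : Finset (Word A × ℚ)) (ε : ℝ) (m : ℕ) :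
    FinDep m (freqBox C ε m) := fun x y h hx p hp => by
  rw [← freqWord_eq_of_eqOn p.1.2 h]
  exact hx p hp

omit [Fintype A] in
/-- A point outside the closure of the word probabilities of `K` is separated from `K` by a box
with rational centre. -/
lemma exists_rat_box {K : Set (Measure (ℕ → A))} {v : Word A → ℝ}
    (hv : v ∉ closure (wordVec '' K)) :
    ∃ (C : Finset (Word A × ℚ)) (e : ℕ), (∀ p ∈ C, |v p.1 - p.2| < 1 / ((e : ℝ) + 1)) ∧
      ∀ ν ∈ K, ∃ p ∈ C, 1 / ((e : ℝ) + 1) < |wordVec ν p.1 - p.2| := by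
  classical
  obtain ⟨I, u, hu, hsub⟩ := isOpen_pi_iff.1 isClosed_closure.isOpen_compl v hv
  have hlim : Tendsto (fun n : ℕ => 2 * (1 / ((n : ℝ) + 1))) atTop (𝓝 0) := by
    simpa using tendsto_one_div_add_atTop_nhds_zero_nat.const_mul (2 : ℝ)
  have hev : ∀ᶠ e : ℕ in atTop, ∀ a ∈ I, Metric.ball (v a) (2 * (1 / ((e : ℝ) + 1))) ⊆ u a := by
    refine (eventually_all_finset I).2 fun a ha => ?_
    obtain ⟨δ, hδ, hball⟩ := Metric.isOpen_iff.1 (hu a ha).1 _ (hu a ha).2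
    filter_upwards [hlim.eventually (gt_mem_nhds hδ)] with e he
    exact (Metric.ball_subset_ball he.le).trans hball
  obtain ⟨e, he⟩ := hev.exists
  have hε : (0 : ℝ) < 1 / ((e : ℝ) + 1) := by positivity
  choose q hq using fun a => exists_rat_near (v a) hε
  refine ⟨I.image fun a => (a, q a), e, fun p hp => ?_, fun ν hν => ?_⟩
  · obtain ⟨a, -, rfl⟩ := Finset.mem_image.1 hp
    exact hq a
  · by_contra! hcon
    refine hsub (a := wordVec ν) (fun a ha => he a ha ?_) (subset_closure ⟨ν, hν, rfl⟩)
    have h1 := hcon _ (Finset.mem_image_of_mem _ ha)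
    have h2 := hq a
    rw [Metric.mem_ball, Real.dist_eq]
    have h3 : wordVec ν a - v a = (wordVec ν a - q a) - (v a - q a) := by ring
    rw [h3]
    linarith [abs_sub (wordVec ν a - q a) (v a - q a)]

/-- The box is rejected by `K`: for every threshold `θ`, there is a bounded time window in which
every element of `K` gives the box probability less than `θ` at some time. -/
def BoxRejected (K : Set (Measure (ℕ → A))) (C : Finset (Word A × ℚ)) (ε : ℝ) (m₀ : ℕ) : Prop :=
  ∀ θ : ℝ, 0 < θ → ∃ N : ℕ, ∀ ρ ∈ K, ∃ m ∈ Finset.Icc m₀ N, ρ.real (freqBox C ε m) < θ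

/-- The empirical frequency of an event that depends on the first `m` symbols. -/
noncomputable def eventFreq (m : ℕ) (S : Set (ℕ → A)) (n : ℕ) (x : ℕ → A) : ℝ :=
  ∑ B ∈ wordsOf m S, freqWord B n x

variable [MeasurableSingletonClass A]

lemma boxRejected_of_disjoint {K : Set (Measure (ℕ → A))}
    (hK : ∀ ρ ∈ K, IsProbabilityMeasure ρ ∧ Stationary ρ)
    (hdec : ∀ ρ : Measure (ℕ → A), IsProbabilityMeasure ρ → Stationary ρ →
      wordVec ρ ∈ closure (wordVec '' K) → ∀ κ : (ℕ → A) → Measure (ℕ → A), Measurable κ →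
      (∀ᵐ x ∂ρ, StatErg (κ x)) → (∀ s, MeasurableSet s → ρ s = ∫⁻ x, κ x s ∂ρ) →
      ∀ᵐ x ∂ρ, κ x ∈ K)
    {C : Finset (Word A × ℚ)} {ε : ℝ}
    (hC : ∀ ν ∈ K, ∃ p ∈ C, ε < |wordVec ν p.1 - p.2|) (m₀ : ℕ) : BoxRejected K C ε m₀ := by
  by_contra hcon
  simp only [BoxRejected] at hcon
  push Not at hcon
  obtain ⟨θ, hθ, hcon⟩ := hcon
  choose ρ hρK hρ using hcon
  obtain ⟨ρ', hp, hs, hlim⟩ := exists_stationary_limit ρ (fun j => (hK _ (hρK j)).1)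
    fun j => (hK _ (hρK j)).2
  have hcl : wordVec ρ' ∈ closure (wordVec '' K) :=
    mem_closure_of_tendsto (f := fun j => wordVec (ρ j)) (b := (hyperfilter ℕ : Filter ℕ))
      (tendsto_pi_nhds.2 fun w => hlim _ _ (finDep_wordCyl w.2))
      (Eventually.of_forall fun j => ⟨_, hρK j, rfl⟩)
  have hge : ∀ m, m₀ ≤ m → θ ≤ ρ'.real (freqBox C ε m) := fun m hm => by
    refine ge_of_tendsto (hlim _ _ (finDep_freqBox C ε m)) ?_
    filter_upwards [Nat.hyperfilter_le_atTop (eventually_ge_atTop m)] with j hj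
    exact hρ j m (Finset.mem_Icc.2 ⟨hm, hj⟩)
  obtain ⟨κ, hκ, herg, hint, hfreq⟩ := exists_ergodic_decomposition ρ' hs
  have hmem := hdec ρ' hp hs hcl κ hκ herg hint
  have hout : ∀ᵐ x ∂ρ', ∀ᶠ m in atTop, (x ∈ freqBox C ε m ↔ x ∈ (∅ : Set (ℕ → A))) := by
    filter_upwards [hmem, hfreq] with x h1 h2
    obtain ⟨p, hp, hlt⟩ := hC _ h1
    filter_upwards [((h2 _ p.1.2).sub_const (p.2 : ℝ)).abs.eventually (lt_mem_nhds hlt)]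
      with m hm
    simp only [Set.mem_empty_iff_false, iff_false]
    exact fun h => (h p hp).not_gt hm
  have hzero := tendsto_measure_of_ae_tendsto_indicator_of_isFiniteMeasure (μ := ρ') atTop
    MeasurableSet.empty (fun m => (finDep_freqBox C ε m).measurableSet) hout
  rw [measure_empty] at hzero
  have hzero' := (ENNReal.tendsto_toReal ENNReal.zero_ne_top).comp hzero
  refine hθ.not_ge (ge_of_tendsto hzero' ?_)
  filter_upwards [eventually_ge_atTop m₀] with m hm using hge m hm

omit [MeasurableSpace A] [MeasurableSingletonClass A] in
lemma eventFreq_nonneg (m : ℕ) (S : Set (ℕ → A)) (n : ℕ) (x : ℕ → A) : 0 ≤ eventFreq m S n x :=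
  Finset.sum_nonneg fun B _ => freqWord_nonneg B n x

lemma integrable_eventFreq (m : ℕ) (S : Set (ℕ → A)) (n : ℕ) (μ : Measure (ℕ → A))
    [IsFiniteMeasure μ] : Integrable (eventFreq m S n) μ :=
  integrable_finsetSum _ fun B _ => integrable_freqWord B n μ

lemma measure_le_eventFreq {μ : Measure (ℕ → A)} [IsFiniteMeasure μ] (hμ : Stationary μ)
    {m n : ℕ} (hmn : m ≤ n) {S : Set (ℕ → A)} (hS : FinDep m S) :
    μ.real {x | 1 / 2 ≤ eventFreq m S n x} ≤ 2 * μ.real S := by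
  have h := mul_meas_ge_le_integral_of_nonneg (μ := μ)
    (Eventually.of_forall (eventFreq_nonneg m S n)) (integrable_eventFreq m S n μ) (1 / 2)
  have h2 : ∫ x, eventFreq m S n x ∂μ = μ.real S := by
    rw [(goodLetters μ).real_eq_sum hS]
    simp only [eventFreq]
    rw [integral_finsetSum _ fun B _ => integrable_freqWord B n μ]
    exact Finset.sum_congr rfl fun B _ => integral_freqWord hμ hmn B
  rw [h2] at h
  linarith

lemma StatErg.ae_tendsto_eventFreq {μ : Measure (ℕ → A)} (hμ : StatErg μ) {m : ℕ}
    {S : Set (ℕ → A)} (hS : FinDep m S) :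
    ∀ᵐ x ∂μ, Tendsto (fun n => eventFreq m S n x) atTop (𝓝 (μ.real S)) := by
  have := hμ.1
  rw [(goodLetters μ).real_eq_sum hS]
  filter_upwards [ae_all_iff.2 fun B : Fin m → A => hμ.ae_tendsto_freqWord B] with x hx
  exact tendsto_finsetSum _ fun B _ => hx B

/-- A test of level `α` which simultaneously detects all rejected boxes. -/
lemma exists_level_test {K : Set (Measure (ℕ → A))}
    (hK : ∀ ρ ∈ K, IsProbabilityMeasure ρ ∧ Stationary ρ) {α : ℝ} (hα : 0 < α) :
    ∃ φ : ℕ → (ℕ → A) → Bool, FinHorizon φ ∧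
      (∀ n, ∀ ρ ∈ K, ρ {x | φ n x = true} ≤ ENNReal.ofReal α) ∧
      ∀ μ : Measure (ℕ → A), StatErg μ → ∀ (C : Finset (Word A × ℚ)) (e m₀ : ℕ),
        BoxRejected K C (1 / ((e : ℝ) + 1)) m₀ →
        (∀ m, m₀ ≤ m → 1 / 2 < μ.real (freqBox C (1 / ((e : ℝ) + 1)) m)) →
        ∀ᵐ x ∂μ, ∀ᶠ n in atTop, φ n x = true := by
  classical
  obtain ⟨θ, hθ, hsum⟩ := ENNReal.exists_pos_sum_of_countable
    (ENNReal.ofReal_pos.2 hα).ne' (Finset (Word A × ℚ) × ℕ × ℕ)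
  let box : Finset (Word A × ℚ) × ℕ × ℕ → ℕ → Set (ℕ → A) := fun i m =>
    freqBox i.1 (1 / ((i.2.1 : ℝ) + 1)) m
  let valid : Finset (Word A × ℚ) × ℕ × ℕ → Prop := fun i =>
    BoxRejected K i.1 (1 / ((i.2.1 : ℝ) + 1)) i.2.2
  have hN : ∀ i, ∃ N : ℕ, valid i →
      ∀ ρ ∈ K, ∃ m ∈ Finset.Icc i.2.2 N, ρ.real (box i m) < θ i / 2 := fun i => by
    by_cases h : valid i
    · obtain ⟨N, hN⟩ := h (θ i / 2) (half_pos (hθ i))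
      exact ⟨N, fun _ => hN⟩
    · exact ⟨0, fun h' => absurd h' h⟩
  choose N hN using hN
  let R : ℕ → Finset (Word A × ℚ) × ℕ × ℕ → Set (ℕ → A) := fun n i =>
    {x | valid i ∧ N i ≤ n ∧ ∀ m ∈ Finset.Icc i.2.2 (N i), 1 / 2 ≤ eventFreq m (box i m) n x}
  refine ⟨fun n x => decide (∃ i, x ∈ R n i), fun n x y hxy => ?_, fun n ρ hρ => ?_,
    fun μ hμ C e m₀ hrej hbig => ?_⟩
  · have h : ∀ m S, eventFreq m S n x = eventFreq m S n y := fun m S =>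
      Finset.sum_congr rfl fun B _ => freqWord_eq_of_eqOn B hxy
    simp only [R, Set.mem_ofPred_eq, h]
  · have h1 : {x | decide (∃ i, x ∈ R n i) = true} = ⋃ i, R n i := by
      ext x; simp
    rw [h1]
    refine (measure_iUnion_le _).trans ((ENNReal.tsum_le_tsum fun i => ?_).trans hsum.le)
    by_cases hv : valid i ∧ N i ≤ n
    · have := (hK ρ hρ).1
      obtain ⟨m, hm, hlt⟩ := hN i hv.1 ρ hρ
      have hle := measure_le_eventFreq (hK ρ hρ).2 ((Finset.mem_Icc.1 hm).2.trans hv.2)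
        (finDep_freqBox i.1 (1 / ((i.2.1 : ℝ) + 1)) m)
      have hsub : R n i ⊆ {x | 1 / 2 ≤ eventFreq m (box i m) n x} := fun x hx => hx.2.2 m hm
      refine (measure_mono hsub).trans ?_
      rw [← ofReal_measureReal, ← ENNReal.ofReal_coe_nnreal]
      exact ENNReal.ofReal_le_ofReal (by simp only [box] at hlt ⊢; linarith)
    · have : R n i = ∅ := Set.eq_empty_of_forall_notMem fun x hx => hv ⟨hx.1, hx.2.1⟩
      simp [this]
  · let i : Finset (Word A × ℚ) × ℕ × ℕ := (C, e, m₀)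
    have hall : ∀ᵐ x ∂μ, ∀ m, Tendsto (fun n => eventFreq m (box i m) n x) atTop
        (𝓝 (μ.real (box i m))) :=
      ae_all_iff.2 fun m => hμ.ae_tendsto_eventFreq (finDep_freqBox _ _ m)
    filter_upwards [hall] with x hx
    have hev : ∀ᶠ n in atTop, ∀ m ∈ Finset.Icc i.2.2 (N i), 1 / 2 < eventFreq m (box i m) n x :=
      (eventually_all_finset _).2 fun m hm =>
        (hx m).eventually (lt_mem_nhds (hbig m (Finset.mem_Icc.1 hm).1))
    filter_upwards [hev, eventually_ge_atTop (N i)] with n h1 h2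
    exact decide_eq_true ⟨i, hrej, h2, fun m hm => (h1 m hm).le⟩

/-- Existence of a consistent test for a set of stationary distributions whose closure has
ergodic components in the set. -/
theorem exists_test_of_decomposition {K : Set (Measure (ℕ → A))}
    (hK : ∀ ρ ∈ K, IsProbabilityMeasure ρ ∧ Stationary ρ)
    (hdec : ∀ ρ : Measure (ℕ → A), IsProbabilityMeasure ρ → Stationary ρ →
      wordVec ρ ∈ closure (wordVec '' K) → ∀ κ : (ℕ → A) → Measure (ℕ → A), Measurable κ →
      (∀ᵐ x ∂ρ, StatErg (κ x)) → (∀ s, MeasurableSet s → ρ s = ∫⁻ x, κ x s ∂ρ) →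
      ∀ᵐ x ∂ρ, κ x ∈ K) :
    ∃ ψ : ℝ → ℕ → (ℕ → A) → Bool, (∀ α, FinHorizon (ψ α)) ∧ AsymConsistent ψ K (ergSet A \ K) := by
  have h : ∀ α : ℝ, ∃ φ : ℕ → (ℕ → A) → Bool, FinHorizon φ ∧ (0 < α →
      (∀ n, ∀ ρ ∈ K, ρ {x | φ n x = true} ≤ ENNReal.ofReal α) ∧
      ∀ μ : Measure (ℕ → A), StatErg μ → ∀ (C : Finset (Word A × ℚ)) (e m₀ : ℕ),
        BoxRejected K C (1 / ((e : ℝ) + 1)) m₀ →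
        (∀ m, m₀ ≤ m → 1 / 2 < μ.real (freqBox C (1 / ((e : ℝ) + 1)) m)) →
        ∀ᵐ x ∂μ, ∀ᶠ n in atTop, φ n x = true) := fun α => by
    by_cases hα : 0 < α
    · obtain ⟨φ, h1, h2⟩ := exists_level_test hK hα
      exact ⟨φ, h1, fun _ => h2⟩
    · exact ⟨fun _ _ => false, fun _ _ _ _ => rfl, fun h => absurd h hα⟩
  choose ψ hψ hψ' using h
  refine ⟨ψ, hψ, fun α hα => (hψ' α hα.1).1, fun α hα μ hμ => ?_⟩
  obtain ⟨hμ, hμK⟩ := hμ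
  have hprob : IsProbabilityMeasure μ := hμ.1
  have hncl : wordVec μ ∉ closure (wordVec '' K) := fun hcl => by
    obtain ⟨x, hx⟩ := (hdec μ hμ.1 hμ.2.1 hcl (fun _ => μ) measurable_const
      (Eventually.of_forall fun _ => hμ) (by simp)).exists
    exact hμK hx
  obtain ⟨C, e, hCμ, hCK⟩ := exists_rat_box hncl
  have hin : ∀ᵐ x ∂μ, ∀ᶠ m in atTop,
      (x ∈ freqBox C (1 / ((e : ℝ) + 1)) m ↔ x ∈ (Set.univ : Set (ℕ → A))) := by
    filter_upwards [ae_all_iff.2 fun w : Word A => hμ.ae_tendsto_freqWord w.2] with x hx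
    have : ∀ᶠ m in atTop, ∀ p ∈ C, |freqWord p.1.2 m x - p.2| < 1 / ((e : ℝ) + 1) :=
      (eventually_all_finset _).2 fun p hp =>
        ((hx p.1).sub_const (p.2 : ℝ)).abs.eventually (gt_mem_nhds (hCμ p hp))
    filter_upwards [this] with m hm
    simp only [Set.mem_univ, iff_true]
    exact fun p hp => (hm p hp).le
  have hone := tendsto_measure_of_ae_tendsto_indicator_of_isFiniteMeasure (μ := μ) atTop
    MeasurableSet.univ (fun m => (finDep_freqBox C _ m).measurableSet) hin
  rw [measure_univ] at hone
  have hone' := (ENNReal.tendsto_toReal ENNReal.one_ne_top).comp hone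
  obtain ⟨m₀, hm₀⟩ := eventually_atTop.1
    (hone'.eventually (lt_mem_nhds (by norm_num : (1 / 2 : ℝ) < ENNReal.toReal 1)))
  exact (hψ' α hα.1).2 μ hμ C e m₀ (boxRejected_of_disjoint hK hdec hCK m₀) hm₀

end LevelTest

section Letters

omit [Fintype A] in
/-- Changing letters within atoms does not affect measurable events. -/
lemma preimage_eq_of_measurableAtom {f : A → A}
    (hf : ∀ s : Set A, MeasurableSet s → f ⁻¹' s = s) {S : Set (ℕ → A)} (hS : MeasurableSet S) :
    (fun (x : ℕ → A) i => f (x i)) ⁻¹' S = S := by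
  induction MeasurableSpace.measurableSet_iSup.1 hS with
  | basic t ht =>
    obtain ⟨i, s, hs, rfl⟩ := ht
    change (fun x : ℕ → A => x i) ⁻¹' (f ⁻¹' s) = _
    rw [hf s hs]
  | empty => simp
  | compl t _ ih => rw [Set.preimage_compl, ih (MeasurableSpace.measurableSet_iSup.2 ‹_›)]
  | iUnion t _ ih =>
    rw [Set.preimage_iUnion]
    exact Set.iUnion_congr fun n => ih n (MeasurableSpace.measurableSet_iSup.2 (by solve_by_elim))

omit [Fintype A] in
open Classical in
lemma preimage_ite_measurableAtom {a c : A} (hc : c ∈ measurableAtom a) {s : Set A}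
    (hs : MeasurableSet s) : (fun d => if d ∈ measurableAtom a then c else d) ⁻¹' s = s := by
  have key : ∀ d ∈ measurableAtom a, (d ∈ s ↔ a ∈ s) := fun d hd =>
    ⟨fun h => by_contra fun h' => mem_of_mem_measurableAtom hd hs.compl h' h,
      fun h => mem_of_mem_measurableAtom hd hs h⟩
  ext d
  by_cases hd : d ∈ measurableAtom a
  · simp [hd, key d hd, key c hc]
  · simp [hd]

/-- An ergodic distribution does not charge the atoms of `A` that are not singletons. -/
lemma StatErg.measure_measurableAtom_eq_zero {μ : Measure (ℕ → A)} (hμ : StatErg μ) {a : A}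
    (ha : ¬ MeasurableSet ({a} : Set A)) : μ {x | x 0 ∈ measurableAtom a} = 0 := by
  classical
  obtain ⟨hprob, hs, herg⟩ := hμ
  have hmp := hs.measurePreserving
  have hatom : MeasurableSet (measurableAtom a) := MeasurableSet.measurableAtom_of_countable a
  obtain ⟨b, hb, hba⟩ : ∃ b ∈ measurableAtom a, b ≠ a := by
    by_contra! h
    exact ha ((Set.Subset.antisymm h (by simp) : measurableAtom a = {a}) ▸ hatom)
  let F : A → (ℕ → A) → ℕ → A := fun c x i => if x i ∈ measurableAtom a then c else x i
  obtain ⟨c, hc⟩ := herg 1 fun _ => a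
  obtain ⟨N, hN, hNm, hN0⟩ := exists_measurable_superset_of_null (ae_iff.1 hc)
  have hG : ∀ d ∈ measurableAtom a, ∀ x ∉ N,
      Tendsto (fun n => freqWord (fun _ : Fin 1 => a) n (F d x)) atTop (𝓝 c) := fun d hd x hx => by
    by_contra h
    have hmem : x ∈ F d ⁻¹' N := hN h
    rw [preimage_eq_of_measurableAtom (fun s hs => preimage_ite_measurableAtom hd hs) hNm] at hmem
    exact hx hmem
  have hae : ∀ᵐ x ∂μ, x ∉ N := measure_eq_zero_iff_ae_notMem.1 hN0
  obtain ⟨x, hx⟩ := hae.exists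
  have hFb : ∀ (x : ℕ → A) i, F b x i ≠ a := fun x i => by
    by_cases h : x i ∈ measurableAtom a
    · simpa [F, h] using hba
    · simp only [F, h, if_false]
      exact fun h' => h (h' ▸ mem_measurableAtom_self _)
  have hc0 : c = 0 := by
    refine tendsto_nhds_unique (hG b hb x hx) (tendsto_const_nhds.congr fun n => ?_)
    simp [freqWord, hFb]
  have hFa : ∀ (x : ℕ → A) i, F a x i = a ↔ x i ∈ measurableAtom a := fun x i => by
    by_cases h : x i ∈ measurableAtom a
    · simp [F, h]
    · simp only [F, h, if_false, iff_false]
      exact fun h' => h (h' ▸ mem_measurableAtom_self _)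
  have hS : MeasurableSet {x : ℕ → A | x 0 ∈ measurableAtom a} := measurable_pi_apply 0 hatom
  let f : (ℕ → A) → ℝ := {x : ℕ → A | x 0 ∈ measurableAtom a}.indicator 1
  have hfm : Measurable f := measurable_one.indicator hS
  have hfi : Integrable f μ := (integrable_const (1 : ℝ)).indicator hS
  have havg : ∀ x n, birkhoffAverage ℝ shift f n x =
      birkhoffAverage ℝ shift ((wordCyl fun _ : Fin 1 => a).indicator 1) n (F a x) := fun x n => by
    simp only [birkhoffAverage, birkhoffSum]
    congr 1
    refine Finset.sum_congr rfl fun i _ => ?_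
    simp [f, Set.indicator_apply, wordCyl, iterate_shift_apply, hFa]
  have hzero : μ[f | MeasurableSpace.invariants shift] =ᵐ[μ] 0 := by
    filter_upwards [ae_tendsto_birkhoffAverage hmp hfm hfi, hae] with x h1 h2
    refine tendsto_nhds_unique h1 ?_
    have h3 := hG a (mem_measurableAtom_self a) x h2
    rw [hc0] at h3
    refine h3.congr' ?_
    filter_upwards [eventually_ge_atTop 1] with n hn
    rw [havg, freqWord_eq_birkhoffAverage hn, Nat.sub_add_cancel hn]
  have hint : ∫ x, f x ∂μ = 0 := by
    rw [← integral_condExp (MeasurableSpace.invariants_le shift), integral_congr_ae hzero]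
    simp
  rw [integral_indicator_one hS] at hint
  exact (measureReal_eq_zero_iff).1 hint

variable (A) in
lemma measurableSet_good_letters :
    MeasurableSet {a : A | MeasurableSet ({a} : Set A)} := by
  rw [← Set.biUnion_of_singleton {a : A | MeasurableSet ({a} : Set A)}]
  exact MeasurableSet.biUnion (Set.to_countable _) fun a ha => ha

lemma measurableSet_goodLetters :
    MeasurableSet {x : ℕ → A | ∀ i, MeasurableSet ({x i} : Set A)} := by
  simp only [Set.ofPred_forall]
  exact MeasurableSet.iInter fun i =>
    (measurable_pi_apply (X := fun _ : ℕ => A) i) (measurableSet_good_letters A)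

lemma StatErg.goodLetters {μ : Measure (ℕ → A)} (hμ : StatErg μ) : GoodLetters μ := by
  have h0 : ∀ᵐ x ∂μ, MeasurableSet ({x 0} : Set A) := by
    have : ∀ᵐ x ∂μ, ∀ a : A, ¬ MeasurableSet ({a} : Set A) → x 0 ∉ measurableAtom a :=
      ae_all_iff.2 fun a => by
        by_cases ha : MeasurableSet ({a} : Set A)
        · exact Eventually.of_forall fun x h => absurd ha h
        · filter_upwards [measure_eq_zero_iff_ae_notMem.1 (hμ.measure_measurableAtom_eq_zero ha)]
            with x hx _ using hx
    filter_upwards [this] with x hx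
    by_contra h
    exact hx _ h (mem_measurableAtom_self _)
  refine ae_all_iff.2 fun i => ?_
  filter_upwards [(hμ.2.1.measurePreserving.iterate i).quasiMeasurePreserving.ae h0] with x hx
  simpa [iterate_shift_apply] using hx

/-- A measurable property of all stationary ergodic measures holds almost surely for the
ergodic decomposition. -/
lemma IsErgodicDecomp.ae_statErg {ρ : Measure (ℕ → A)} {W : Measure (Measure (ℕ → A))}
    (h : IsErgodicDecomp ρ W) {p : Measure (ℕ → A) → Prop} (hp : MeasurableSet {μ | p μ})
    (hE : ∀ μ, StatErg μ → p μ) : ∀ᵐ μ ∂W, p μ := by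
  have := h.1
  have h1 : W {μ | p μ} = 1 :=
    le_antisymm prob_le_one (h.2.1 ▸ measure_mono fun μ hμ => hE μ hμ)
  exact (prob_compl_eq_zero_iff hp).2 h1

/-- A mixture of ergodic distributions does not charge letters that are not measurable. -/
lemma IsErgodicDecomp.goodLetters {ρ : Measure (ℕ → A)} {W : Measure (Measure (ℕ → A))}
    (h : IsErgodicDecomp ρ W) : GoodLetters ρ := by
  have hm := (measurableSet_goodLetters (A := A)).compl
  have hz := h.ae_statErg (p := fun μ => μ {x : ℕ → A | ∀ i, MeasurableSet ({x i} : Set A)}ᶜ = 0)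
    (Measure.measurable_coe hm (measurableSet_singleton 0)) fun μ hμ => hμ.goodLetters
  change ρ {x : ℕ → A | ∀ i, MeasurableSet ({x i} : Set A)}ᶜ = 0
  rw [h.2.2 _ hm, lintegral_congr_ae hz]
  simp

end Letters

section Distance

lemma wt_pos (k : ℕ) : 0 < wt k := by
  unfold wt
  positivity

lemma summable_wt : Summable wt := by
  have h : Summable fun k : ℕ => 1 / ((k + 1 : ℕ) : ℝ) ^ 2 :=
    (summable_nat_add_iff 1).2 (Real.summable_one_div_nat_pow.2 one_lt_two)
  refine h.of_nonneg_of_le (fun k => (wt_pos k).le) fun k => ?_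
  unfold wt
  push_cast
  have : (0 : ℝ) ≤ k := k.cast_nonneg
  exact one_div_le_one_div_of_le (by positivity) (by nlinarith)

lemma GoodLetters.sum_abs_sub_le {μ ν : Measure (ℕ → A)} [IsProbabilityMeasure μ]
    [IsProbabilityMeasure ν] (hμ : GoodLetters μ) (hν : GoodLetters ν) (n : ℕ) :
    ∑ B : Fin n → A, |μ.real (wordCyl B) - ν.real (wordCyl B)| ≤ 2 := by
  have h : ∑ B : Fin n → A, |μ.real (wordCyl B) - ν.real (wordCyl B)| ≤
      ∑ B : Fin n → A, (μ.real (wordCyl B) + ν.real (wordCyl B)) :=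
    Finset.sum_le_sum fun B _ => by
      have h := abs_sub (μ.real (wordCyl B)) (ν.real (wordCyl B))
      rwa [abs_of_nonneg (measureReal_nonneg (μ := μ)),
        abs_of_nonneg (measureReal_nonneg (μ := ν))] at h
  rw [Finset.sum_add_distrib] at h
  linarith [hμ.sum_wordCyl n, hν.sum_wordCyl n]

lemma GoodLetters.wt_mul_sum_le_dd {μ ν : Measure (ℕ → A)} [IsProbabilityMeasure μ]
    [IsProbabilityMeasure ν] (hμ : GoodLetters μ) (hν : GoodLetters ν) (n : ℕ) :
    wt n * ∑ B : Fin (n + 1) → A, |μ.real (wordCyl B) - ν.real (wordCyl B)| ≤ dd μ ν := by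
  have hnn : ∀ k, 0 ≤ wt k * ∑ B : Fin (k + 1) → A, |μ.real (wordCyl B) - ν.real (wordCyl B)| :=
    fun k => mul_nonneg (wt_pos k).le (Finset.sum_nonneg fun B _ => abs_nonneg _)
  have hsum := (summable_wt.mul_right 2).of_nonneg_of_le hnn fun k =>
    mul_le_mul_of_nonneg_left (hμ.sum_abs_sub_le hν (k + 1)) (wt_pos k).le
  exact hsum.le_tsum n fun k _ => hnn k

/-- Bounds on the probability of finite-dimensional events pass to the closure. -/
lemma measure_le_of_mem_closureD {H : Set (Measure (ℕ → A))} (hH : H ⊆ ergSet A)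
    {ρ : Measure (ℕ → A)} (hρ : ρ ∈ closureD H) (hgood : GoodLetters ρ) {n : ℕ}
    {S : Set (ℕ → A)} (hS : FinDep n S) {α : ℝ} (hα : 0 ≤ α)
    (hle : ∀ ν ∈ H, ν S ≤ ENNReal.ofReal α) : ρ S ≤ ENNReal.ofReal α := by
  have hp := hρ.1
  have hS' : FinDep (n + 1) S := fun x y h => hS x y fun i hi => h i (by omega)
  rw [← ofReal_measureReal]
  refine ENNReal.ofReal_le_ofReal (le_of_forall_pos_le_add fun ε hε => ?_)
  obtain ⟨ν, hνH, hν⟩ := hρ.2.2 (wt n * ε) (mul_pos (wt_pos n) hε)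
  have hνE : StatErg ν := hH hνH
  have hνp := hνE.1
  have h1 := (hgood.wt_mul_sum_le_dd hνE.goodLetters n).trans hν.le
  have h2 := le_of_mul_le_mul_left h1 (wt_pos n)
  have h3 : ν.real S ≤ α := ENNReal.toReal_le_of_le_ofReal hα (hle ν hνH)
  have h4 : ρ.real S - ν.real S ≤ ε := by
    rw [hgood.real_eq_sum hS', hνE.goodLetters.real_eq_sum hS', ← Finset.sum_sub_distrib]
    refine (Finset.sum_le_sum fun B _ => le_abs_self _).trans ?_
    exact (Finset.sum_le_univ_sum_of_nonneg fun B => abs_nonneg _).trans h2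
  linarith

/-- Consistent tests at all levels force the closure of the hypothesis to have its ergodic
components outside the alternative. -/
lemma decomp_eq_zero_of_asymConsistent {H₀ H₁ : Set (Measure (ℕ → A))} (hsub : H₀ ⊆ ergSet A)
    (hsub₁ : H₁ ⊆ ergSet A) {ψ : ℝ → ℕ → (ℕ → A) → Bool} (hmeas : ∀ α n, Measurable (ψ α n))
    (hfin : ∀ α, FinHorizon (ψ α)) (hψ : AsymConsistent ψ H₀ H₁) {ρ : Measure (ℕ → A)}
    (hρ : ρ ∈ closureD H₀) {W : Measure (Measure (ℕ → A))} (hW : IsErgodicDecomp ρ W) :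
    W H₁ = 0 := by
  have hbound : ∀ α ∈ Set.Ioo (0 : ℝ) 1, W H₁ ≤ ENNReal.ofReal α := fun α hα => by
    have hS : ∀ n, MeasurableSet {x | ψ α n x = true} := fun n =>
      hmeas α n (measurableSet_singleton true)
    have hm : ∀ n, Measurable fun μ : Measure (ℕ → A) => μ {x | ψ α n x = true} := fun n =>
      Measure.measurable_coe (hS n)
    have hlevel : ∀ n, ∫⁻ μ, μ {x | ψ α n x = true} ∂W ≤ ENNReal.ofReal α := fun n => by
      rw [← hW.2.2 _ (hS n)]
      refine measure_le_of_mem_closureD hsub hρ hW.goodLetters (n := n) (fun x y h hx => ?_)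
        hα.1.le fun ν hν => hψ.1 α hα n ν hν
      exact (hfin α n x y h).symm.trans hx
    have hone : ∀ μ ∈ H₁, 1 ≤ liminf (fun n => μ {x | ψ α n x = true}) atTop := fun μ hμ => by
      have := (hsub₁ hμ).1
      have h := tendsto_measure_of_ae_tendsto_indicator_of_isFiniteMeasure (μ := μ) atTop
        MeasurableSet.univ hS (by
          filter_upwards [hψ.2 α hα μ hμ] with x hx
          filter_upwards [hx] with n hn
          simpa using hn)
      rw [h.liminf_eq, measure_univ]
    calc W H₁ ≤ W {μ | 1 ≤ liminf (fun n => μ {x | ψ α n x = true}) atTop} :=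
          measure_mono hone
      _ ≤ ∫⁻ μ, liminf (fun n => μ {x | ψ α n x = true}) atTop ∂W := by
          simpa using mul_meas_ge_le_lintegral (μ := W) (Measurable.liminf hm) 1
      _ ≤ liminf (fun n => ∫⁻ μ, μ {x | ψ α n x = true} ∂W) atTop := lintegral_liminf_le hm
      _ ≤ ENNReal.ofReal α := by
          refine liminf_le_of_frequently_le' (Frequently.of_forall hlevel)
  have h := (ENNReal.continuous_ofReal.tendsto 0).mono_left
    (nhdsWithin_le_nhds (s := Set.Ioi (0 : ℝ)))
  rw [ENNReal.ofReal_zero] at h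
  refine le_antisymm (ge_of_tendsto h ?_) zero_le
  filter_upwards [Ioo_mem_nhdsGT one_pos] with α hα using hbound α hα

end Distance

section Transfer

/-- The letters of `A` whose singletons are measurable. -/
abbrev GoodLetter (A : Type*) [MeasurableSpace A] := {a : A // MeasurableSet ({a} : Set A)}

noncomputable instance : Fintype (GoodLetter A) := Fintype.ofFinite _

omit [Fintype A] in
instance : MeasurableSingletonClass (GoodLetter A) :=
  ⟨fun a => ⟨{a.1}, a.2, by ext b; simp [Subtype.ext_iff]⟩⟩

/-- The inclusion of sequences of good letters. -/
def emb (y : ℕ → GoodLetter A) : ℕ → A := fun i => y i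

omit [Fintype A] in
lemma measurable_emb : Measurable (emb : (ℕ → GoodLetter A) → ℕ → A) :=
  measurable_pi_lambda _ fun i => measurable_subtype_coe.comp (measurable_pi_apply i)

omit [Fintype A] in
lemma freqWord_emb {k : ℕ} (B : Fin k → GoodLetter A) (n : ℕ) (y : ℕ → GoodLetter A) :
    freqWord (fun i => (B i : A)) n (emb y) = freqWord B n y := by
  have h : ∀ i, (∀ j : Fin k, emb y (i + j) = (B j : A)) ↔ ∀ j : Fin k, y (i + j) = B j :=
    fun i => forall_congr' fun j => Subtype.ext_iff.symm
  unfold freqWord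
  split_ifs
  · refine congrArg (· / _) (Finset.sum_congr rfl fun i _ => ?_)
    by_cases hi : ∀ j : Fin k, y (i + j) = B j
    · rw [if_pos ((h i).2 hi), if_pos hi]
    · rw [if_neg (hi ∘ (h i).1), if_neg hi]
  · rfl

omit [Fintype A] in
lemma freqWord_emb_of_not {k : ℕ} {B : Fin k → A} (hB : ¬ ∀ i, MeasurableSet ({B i} : Set A))
    (n : ℕ) (y : ℕ → GoodLetter A) : freqWord B n (emb y) = 0 := by
  have h : ∀ i, ¬ ∀ j : Fin k, emb y (i + j) = B j := fun i h =>
    hB fun j => h j ▸ (y (i + j)).2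
  simp [freqWord, h]

lemma goodLetters_map_emb (ν : Measure (ℕ → GoodLetter A)) : GoodLetters (ν.map emb) := by
  refine (ae_map_iff measurable_emb.aemeasurable measurableSet_goodLetters).2 ?_
  exact Eventually.of_forall fun y i => (y i).2

omit [Fintype A] in
lemma map_emb_wordCyl (ν : Measure (ℕ → GoodLetter A)) {k : ℕ} (B : Fin k → GoodLetter A) :
    (ν.map emb).real (wordCyl fun i => (B i : A)) = ν.real (wordCyl B) := by
  rw [map_measureReal_apply measurable_emb (measurableSet_wordCyl_of_letters fun i => (B i).2)]
  congr 1
  ext y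
  simp [wordCyl, emb, Subtype.ext_iff]

omit [Fintype A] in
lemma Stationary.map_letters {A' : Type*} [MeasurableSpace A'] {μ : Measure (ℕ → A)}
    (hμ : Stationary μ) {f : A → A'} (hf : Measurable fun (x : ℕ → A) i => f (x i)) :
    Stationary (μ.map fun x i => f (x i)) := by
  unfold Stationary
  rw [Measure.map_map measurable_shift hf]
  conv_rhs => rw [← hμ, Measure.map_map hf measurable_shift]
  rfl

variable [Nonempty (GoodLetter A)]

open Classical in
/-- A retraction of the alphabet onto the good letters. -/
noncomputable def toGood (a : A) : GoodLetter A :=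
  if h : MeasurableSet ({a} : Set A) then ⟨a, h⟩ else Classical.arbitrary _

lemma measurable_toGood : Measurable (toGood : A → GoodLetter A) := by
  refine measurable_to_countable' fun d => ?_
  by_cases hd : d = Classical.arbitrary (GoodLetter A)
  · have : toGood ⁻¹' {d} = {(d : A)} ∪ {a : A | MeasurableSet ({a} : Set A)}ᶜ := by
      ext a
      by_cases ha : MeasurableSet ({a} : Set A)
      · simp [toGood, ha, Subtype.ext_iff]
      · simp [toGood, ha, hd]
    rw [this]
    exact d.2.union (measurableSet_good_letters A).compl
  · have : toGood ⁻¹' {d} = {(d : A)} := by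
      ext a
      by_cases ha : MeasurableSet ({a} : Set A)
      · simp [toGood, ha, Subtype.ext_iff]
      · simp only [toGood, ha, Set.mem_preimage, Set.mem_singleton_iff, dif_neg, not_false_eq_true]
        exact ⟨fun h => absurd h.symm hd, fun h => absurd (h ▸ d.2) ha⟩
    rw [this]
    exact d.2

/-- The retraction of sequences onto sequences of good letters. -/
noncomputable def ret (x : ℕ → A) : ℕ → GoodLetter A := fun i => toGood (x i)

lemma measurable_ret : Measurable (ret : (ℕ → A) → ℕ → GoodLetter A) :=
  measurable_pi_lambda _ fun i => measurable_toGood.comp (measurable_pi_apply i)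

omit [Fintype A] in
lemma ret_emb (y : ℕ → GoodLetter A) : ret (emb y) = y :=
  funext fun i => by simp [ret, emb, toGood, (y i).2]

omit [Fintype A] in
lemma GoodLetters.ae_emb_ret {μ : Measure (ℕ → A)} (hμ : GoodLetters μ) :
    ∀ᵐ x ∂μ, emb (ret x) = x := by
  filter_upwards [hμ] with x hx
  exact funext fun i => by simp [ret, emb, toGood, hx i]

lemma map_ret_map_emb (ν : Measure (ℕ → GoodLetter A)) : (ν.map emb).map ret = ν := by
  rw [Measure.map_map measurable_ret measurable_emb]
  have : (ret ∘ emb : (ℕ → GoodLetter A) → _) = id := funext ret_emb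
  rw [this, Measure.map_id]

lemma GoodLetters.map_emb_map_ret {μ : Measure (ℕ → A)} (hμ : GoodLetters μ) :
    (μ.map ret).map emb = μ := by
  rw [Measure.map_map measurable_emb measurable_ret]
  have : (emb ∘ ret : (ℕ → A) → _) =ᵐ[μ] id := hμ.ae_emb_ret
  rw [Measure.map_congr this, Measure.map_id]

lemma StatErg.map_ret {μ : Measure (ℕ → A)} (hμ : StatErg μ) : StatErg (μ.map ret) := by
  have := hμ.1
  refine ⟨Measure.isProbabilityMeasure_map measurable_ret.aemeasurable,
    hμ.2.1.map_letters measurable_ret, fun k B => ?_⟩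
  obtain ⟨c, hc⟩ := hμ.2.2 k fun i => (B i : A)
  refine ⟨c, (ae_map_iff measurable_ret.aemeasurable
    (measurableSet_tendsto _ fun n => measurable_freqWord B n)).2 ?_⟩
  filter_upwards [hc, hμ.goodLetters.ae_emb_ret] with x h1 h2
  refine h1.congr fun n => ?_
  rw [← freqWord_emb, h2]

lemma StatErg.map_emb {ν : Measure (ℕ → GoodLetter A)} (hν : StatErg ν) :
    StatErg (ν.map emb) := by
  have := hν.1
  refine ⟨Measure.isProbabilityMeasure_map measurable_emb.aemeasurable,
    hν.2.1.map_letters measurable_emb, fun k B => ?_⟩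
  have hae := (goodLetters_map_emb ν).ae_emb_ret
  by_cases hB : ∀ i, MeasurableSet ({B i} : Set A)
  · obtain ⟨c, hc⟩ := hν.2.2 k fun i => ⟨B i, hB i⟩
    rw [← map_ret_map_emb ν] at hc
    refine ⟨c, ?_⟩
    filter_upwards [ae_of_ae_map measurable_ret.aemeasurable hc, hae] with x h1 h2
    refine h1.congr fun n => ?_
    rw [← freqWord_emb, h2]
  · refine ⟨0, ?_⟩
    filter_upwards [hae] with x hx
    rw [← hx]
    simp only [freqWord_emb_of_not hB, tendsto_const_nhds]

/-- Convergence of word probabilities implies convergence in distributional distance. -/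
lemma map_emb_mem_closureD {H : Set (Measure (ℕ → A))} (hH : H ⊆ ergSet A)
    {ρ : Measure (ℕ → GoodLetter A)} [IsProbabilityMeasure ρ] (hs : Stationary ρ)
    (hcl : wordVec ρ ∈ closure (wordVec '' (Measure.map ret '' H))) :
    ρ.map emb ∈ closureD H := by
  have hp := Measure.isProbabilityMeasure_map (μ := ρ) (f := emb) measurable_emb.aemeasurable
  refine ⟨hp, hs.map_letters measurable_emb, fun ε hε => ?_⟩
  obtain ⟨v, hv, hlim⟩ := mem_closure_iff_seq_limit.1 hcl
  choose! ν hν hνv using hv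
  choose! μ hμ hμν using hν
  have hμE : ∀ j, StatErg (μ j) := fun j => hH (hμ j)
  have hμp : ∀ j, IsProbabilityMeasure (μ j) := fun j => (hμE j).1
  have hgood := goodLetters_map_emb ρ
  have hμemb : ∀ j, μ j = (ν j).map emb := fun j => by
    rw [← hμν j, (hμE j).goodLetters.map_emb_map_ret]
  have hword : ∀ (k : ℕ) (B : Fin k → A), Tendsto
      (fun j => |(ρ.map emb).real (wordCyl B) - (μ j).real (wordCyl B)|) atTop (𝓝 0) :=
    fun k B => by
    by_cases hB : ∀ i, MeasurableSet ({B i} : Set A)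
    · have h1 := (tendsto_pi_nhds.1 hlim) ⟨k, fun i => ⟨B i, hB i⟩⟩
      have h2 := (h1.const_sub (wordVec ρ ⟨k, fun i => ⟨B i, hB i⟩⟩)).abs
      rw [sub_self, abs_zero] at h2
      refine h2.congr fun j => ?_
      rw [hμemb j, map_emb_wordCyl ρ fun i => ⟨B i, hB i⟩,
        map_emb_wordCyl (ν j) fun i => ⟨B i, hB i⟩, ← hνv j]
      rfl
    · refine tendsto_const_nhds.congr fun j => ?_
      simp [measureReal_def, hgood.measure_wordCyl_eq_zero hB,
        (hμE j).goodLetters.measure_wordCyl_eq_zero hB]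
  have hdd : Tendsto (fun j => dd (ρ.map emb) (μ j)) atTop (𝓝 0) := by
    have h := tendsto_tsum_of_dominated_convergence (𝓕 := atTop)
      (f := fun j k => wt k * ∑ B : Fin (k + 1) → A,
        |(ρ.map emb).real (wordCyl B) - (μ j).real (wordCyl B)|)
      (g := fun _ => (0 : ℝ)) (summable_wt.mul_right 2) (fun k => ?_)
      (Eventually.of_forall fun j k => ?_)
    · rwa [tsum_zero] at h
    · have h := (tendsto_finsetSum Finset.univ fun B _ => hword (k + 1) B).const_mul (wt k)
      simpa using h
    · rw [Real.norm_of_nonneg (mul_nonneg (wt_pos k).le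
        (Finset.sum_nonneg fun B _ => abs_nonneg _))]
      exact mul_le_mul_of_nonneg_left (hgood.sum_abs_sub_le (hμE j).goodLetters _) (wt_pos k).le
  obtain ⟨j, hj⟩ := (hdd.eventually (gt_mem_nhds hε)).exists
  exact ⟨μ j, hμ j, hj⟩

lemma isErgodicDecomp_map_emb {ρ : Measure (ℕ → GoodLetter A)} [IsProbabilityMeasure ρ]
    {κ : (ℕ → GoodLetter A) → Measure (ℕ → GoodLetter A)} (hκ : Measurable κ)
    (herg : ∀ᵐ x ∂ρ, StatErg (κ x)) (hint : ∀ s, MeasurableSet s → ρ s = ∫⁻ x, κ x s ∂ρ) :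
    IsErgodicDecomp (ρ.map emb) (ρ.map fun x => (κ x).map emb) := by
  have hm : Measurable fun x => (κ x).map emb := (Measure.measurable_map _ measurable_emb).comp hκ
  have hp := Measure.isProbabilityMeasure_map (μ := ρ) hm.aemeasurable
  refine ⟨hp, le_antisymm prob_le_one ?_, fun s h => ?_⟩
  · refine le_trans ?_ (Measure.le_map_apply hm.aemeasurable _)
    rw [← measure_univ (μ := ρ)]
    refine measure_mono_ae ?_
    filter_upwards [herg] with x hx _ using hx.map_emb
  · rw [Measure.map_apply measurable_emb h, hint _ (measurable_emb h),
      lintegral_map (Measure.measurable_coe h) hm]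
    exact lintegral_congr fun x => (Measure.map_apply measurable_emb h).symm

/-- Existence of a consistent test when all ergodic components of the closure of the hypothesis
avoid the alternative. -/
lemma exists_asymConsistent {H₀ : Set (Measure (ℕ → A))} (hsub : H₀ ⊆ ergSet A)
    (hdec : ∀ ρ ∈ closureD H₀, ∀ W, IsErgodicDecomp ρ W → W (ergSet A \ H₀) = 0) :
    ∃ ψ : ℝ → ℕ → (ℕ → A) → Bool, (∀ α n, Measurable (ψ α n)) ∧ (∀ α, FinHorizon (ψ α)) ∧
      AsymConsistent ψ H₀ (ergSet A \ H₀) := by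
  obtain ⟨ψ, hfin, hψ⟩ := exists_test_of_decomposition (K := Measure.map ret '' H₀)
    (by
      rintro _ ⟨μ, hμ, rfl⟩
      have h : StatErg (μ.map ret) := StatErg.map_ret (hsub hμ)
      exact ⟨h.1, h.2.1⟩)
    (fun ρ hp hs hcl κ hκ herg hint => by
      have h0 := hdec _ (map_emb_mem_closureD hsub hs hcl) _
        (isErgodicDecomp_map_emb hκ herg hint)
      have hm : Measurable fun x => (κ x).map emb :=
        (Measure.measurable_map _ measurable_emb).comp hκ
      have hae : ∀ᵐ x ∂ρ, (κ x).map emb ∉ ergSet A \ H₀ :=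
        ae_of_ae_map hm.aemeasurable (measure_eq_zero_iff_ae_notMem.1 h0)
      filter_upwards [herg, hae] with x h1 h2
      have h3 : (κ x).map emb ∈ H₀ := by_contra fun h => h2 ⟨h1.map_emb, h⟩
      exact ⟨_, h3, map_ret_map_emb _⟩)
  have hmeas : ∀ α n, Measurable (ψ α n) := fun α n => measurable_of_finHorizon (hfin α) n
  refine ⟨fun α n x => ψ α n (ret x), fun α n => (hmeas α n).comp measurable_ret,
    fun α n x y h => hfin α n _ _ fun i hi => by simp only [ret, h i hi],
    fun α hα n ρ hρ => ?_, fun α hα μ hμ => ?_⟩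
  · have h := hψ.1 α hα n _ ⟨ρ, hρ, rfl⟩
    have hset : MeasurableSet {x | ψ α n x = true} := hmeas α n (measurableSet_singleton true)
    rwa [Measure.map_apply measurable_ret hset] at h
  · have hμE : StatErg μ := hμ.1
    refine ae_of_ae_map measurable_ret.aemeasurable (hψ.2 α hα (μ.map ret) ⟨hμE.map_ret, ?_⟩)
    rintro ⟨μ', hμ', heq⟩
    have hμ'E : StatErg μ' := hsub hμ'
    have h := congrArg (Measure.map emb) heq
    rw [hμ'E.goodLetters.map_emb_map_ret, hμE.goodLetters.map_emb_map_ret] at h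
    exact hμ.2 (h ▸ hμ')

end Transfer

/-- criterion for asymmetric testing against the complement. For
measurable `H₀ ⊆ E` and `H₁ = E ∖ H₀`, an asymmetrically consistent test for `H₀` against
`H₁` exists if and only if `W_ρ(H₁) = 0` for every `ρ` in the closure of `H₀`. -/
theorem asymmetric_test_criterion (H₀ : Set (Measure (ℕ → A)))
    (hsub : H₀ ⊆ ergSet A) (hmeas : MeasurableSet H₀) :
    (∃ ψ : ℝ → ℕ → (ℕ → A) → Bool,
      (∀ α n, Measurable (ψ α n)) ∧ (∀ α, FinHorizon (ψ α)) ∧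
      AsymConsistent ψ H₀ (ergSet A \ H₀)) ↔
    (∀ ρ ∈ closureD H₀, ∀ W, IsErgodicDecomp ρ W → W (ergSet A \ H₀) = 0) := by
  refine ⟨fun ⟨ψ, hψm, hψf, hψ⟩ ρ hρ W hW =>
    decomp_eq_zero_of_asymConsistent hsub Set.sdiff_subset hψm hψf hψ hρ hW, fun hdec => ?_⟩
  by_cases hne : Nonempty (GoodLetter A)
  · exact exists_asymConsistent hsub hdec
  · have hE : ∀ μ ∈ ergSet A, False := fun μ hμ => by
      have := hμ.1
      obtain ⟨x, hx⟩ := (StatErg.goodLetters hμ).exists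
      exact hne ⟨⟨x 0, hx 0⟩⟩
    exact ⟨fun _ _ _ => true, fun _ _ => measurable_const, fun _ _ _ _ _ => rfl,
      fun _ _ _ ρ hρ => (hE ρ (hsub hρ)).elim, fun _ _ ρ hρ => (hE ρ hρ.1).elim⟩


end Paper
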